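/- Let H be a non-abelian finite simple group, and suppose there are ordered pairs (T_{1,s}, T_{2,s}), s = 1,…,t, of generating triples of H such that: (1) for every prime p dividing |H| there is some s for which T_{1,s} and T_{2,s} are a p-distinguishing pair; and (2) the 6t triples consisting of all the T_{i,s} (i = 1,2; s = 1,…,t) together with all their cyclic permutations are pairwise inequivalent under Aut(H). Then for every integer k with 6t ≤ k and k·|Aut H| ≤ φ₂(H), the direct power Hᵏ admits an unmixed Beauville structure. -/

import Mathlib

open scoped MatrixGroups

/-- `Σ(T)`: the union of all conjugates of the cyclic subgroups generated by the
three entries of the triple `T = (a, b, c)`. -/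
def SigmaSet {G : Type*} [Group G] (T : G × G × G) : Set G :=
  {x | ∃ g : G, g * x * g⁻¹ ∈
    (Subgroup.zpowers T.1 : Set G) ∪ (Subgroup.zpowers T.2.1 : Set G) ∪
      (Subgroup.zpowers T.2.2 : Set G)}

/-- `T = (a,b,c)` is a generating triple: `a*b*c = 1` and `{a,b,c}` generates. -/
def IsGenTriple {G : Type*} [Group G] (T : G × G × G) : Prop :=
  T.1 * T.2.1 * T.2.2 = 1 ∧ Subgroup.closure {T.1, T.2.1, T.2.2} = ⊤

/-- `T` is hyperbolic: the reciprocals of the orders of its entries sum to less than 1. -/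
def IsHyperbolic {G : Type*} [Group G] (T : G × G × G) : Prop :=
  (orderOf T.1 : ℚ)⁻¹ + (orderOf T.2.1 : ℚ)⁻¹ + (orderOf T.2.2 : ℚ)⁻¹ < 1

/-- An unmixed Beauville structure on `G`: a pair of hyperbolic generating triples
`T₁, T₂` with `Σ(T₁) ∩ Σ(T₂) = {1}`. -/
def HasBeauvilleStructure (G : Type*) [Group G] : Prop :=
  ∃ T₁ T₂ : G × G × G, IsGenTriple T₁ ∧ IsHyperbolic T₁ ∧ IsGenTriple T₂ ∧ IsHyperbolic T₂ ∧
    SigmaSet T₁ ∩ SigmaSet T₂ = {1}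

/-- `φ₂(H)`: the number of ordered generating pairs of `H`. -/
noncomputable def phi2 (H : Type*) [Group H] : ℕ :=
  Nat.card {p : H × H // Subgroup.closure {p.1, p.2} = ⊤}

/-- Two triples are equivalent if some automorphism carries one to the other entrywise. -/
def TripleEquiv {H : Type*} [Group H] (T T' : H × H × H) : Prop :=
  ∃ α : MulAut H, α T.1 = T'.1 ∧ α T.2.1 = T'.2.1 ∧ α T.2.2 = T'.2.2

/-- The `p`-summit of `d ∈ Hᵏ`: the set of indices at which the `p`-adic valuation of the
order of the coordinate attains its maximum over all coordinates. -/
def pSummit {H : Type*} [Group H] {k : ℕ} (p : ℕ) (d : Fin k → H) : Set (Fin k) :=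
  {j | ∀ j', (orderOf (d j')).factorization p ≤ (orderOf (d j)).factorization p}

/-- An element `h` of `H` is `p`-full if the highest power of `p` dividing the exponent of
`H` divides the order of `h`. -/
def PFull (H : Type*) [Group H] (p : ℕ) (h : H) : Prop :=
  p ^ (Monoid.exponent H).factorization p ∣ orderOf h

open scoped Classical in
/-- `ν_p(T)`: the number of `p`-full entries of the triple `T`. -/
noncomputable def nuP {H : Type*} [Group H] (p : ℕ) (T : H × H × H) : ℕ :=
  (if PFull H p T.1 then 1 else 0) + (if PFull H p T.2.1 then 1 else 0) +
    (if PFull H p T.2.2 then 1 else 0)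

/-- Two triples are `p`-distinguishing if `ν_p(T₁) ≠ ν_p(T₂)`. -/
def PDistinguishing {H : Type*} [Group H] (p : ℕ) (T₁ T₂ : H × H × H) : Prop :=
  nuP p T₁ ≠ nuP p T₂

/-- Two triples are strongly `p`-distinguishing if they are `p`-distinguishing and whenever
`ν_p(T_i) = 0` then either `p²` does not divide the exponent of `H` or `p` divides none of
the orders of the entries of `T_i`. -/
def StronglyPDistinguishing {H : Type*} [Group H] (p : ℕ) (T₁ T₂ : H × H × H) : Prop :=
  PDistinguishing p T₁ T₂ ∧
    ∀ T ∈ ({T₁, T₂} : Set (H × H × H)), nuP p T = 0 →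
      ¬ (p ^ 2 ∣ Monoid.exponent H) ∨
        (¬ p ∣ orderOf T.1 ∧ ¬ p ∣ orderOf T.2.1 ∧ ¬ p ∣ orderOf T.2.2)

/-- The cyclic shift of a triple: `(x, y, z) ↦ (y, z, x)`. -/
def cycShift {H : Type*} (T : H × H × H) : H × H × H := (T.2.1, T.2.2, T.1)

section DirectPower

variable {H : Type*} [Group H] {ι : Type*}

/-- The elements of `H` occurring as the `i`-th coordinate of an element of `K` whose coordinates
in `S` are trivial. -/
def coordSubgroup (K : Subgroup (ι → H)) (S : Set ι) (i : ι) : Subgroup H :=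
  (K ⊓ Subgroup.pi S fun _ => ⊥).map (Pi.evalMonoidHom (fun _ => H) i)

lemma mem_coordSubgroup {K : Subgroup (ι → H)} {S : Set ι} {i : ι} {h : H} :
    h ∈ coordSubgroup K S i ↔ ∃ x ∈ K, (∀ j ∈ S, x j = 1) ∧ x i = h := by
  simp [coordSubgroup, Subgroup.mem_map, Subgroup.mem_pi, and_assoc]

lemma coordSubgroup_normal {K : Subgroup (ι → H)} {i : ι} (hK : ∀ h, ∃ x ∈ K, x i = h)
    (S : Set ι) : (coordSubgroup K S i).Normal := by
  refine ⟨fun h hh g => ?_⟩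
  obtain ⟨x, hxK, hxS, rfl⟩ := mem_coordSubgroup.1 hh
  obtain ⟨y, hyK, rfl⟩ := hK g
  exact mem_coordSubgroup.2 ⟨y * x * y⁻¹, K.mul_mem (K.mul_mem hyK hxK) (K.inv_mem hyK),
    fun j hj => by simp [hxS j hj], rfl⟩

/-- Goursat's lemma for direct powers of a non-abelian simple group. -/
lemma subgroup_pi_eq_top [IsSimpleGroup H] [Finite ι] (hna : ¬ ∀ x y : H, x * y = y * x)
    {K : Subgroup (ι → H)} (hsurj : ∀ i h, ∃ x ∈ K, x i = h)
    (hsep : ∀ i j, i ≠ j → ∃ x ∈ K, x j = 1 ∧ x i ≠ 1) : K = ⊤ := by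
  classical
  have := Fintype.ofFinite ι
  have hpair : ∀ i j, i ≠ j → coordSubgroup K {j} i = ⊤ := fun i j hij => by
    refine ((coordSubgroup_normal (hsurj i) _).eq_bot_or_eq_top).resolve_left fun hbot => ?_
    obtain ⟨x, hxK, hxj, hxi⟩ := hsep i j hij
    have : x i ∈ coordSubgroup K {j} i := mem_coordSubgroup.2 ⟨x, hxK, by simpa using hxj, rfl⟩
    rw [hbot] at this
    exact hxi (Subgroup.mem_bot.1 this)
  have hall : ∀ (i : ι) (S : Finset ι), i ∉ S → coordSubgroup K S i = ⊤ := by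
    intro i S
    induction S using Finset.induction_on with
    | empty =>
      refine fun _ => eq_top_iff.2 fun h _ => ?_
      obtain ⟨x, hx, hxi⟩ := hsurj i h
      exact mem_coordSubgroup.2 ⟨x, hx, by simp, hxi⟩
    | insert j S _ ih =>
      intro hi
      rw [Finset.mem_insert, not_or] at hi
      refine ((coordSubgroup_normal (hsurj i) _).eq_bot_or_eq_top).resolve_left fun hbot => ?_
      refine hna fun a b => ?_
      have ha : a ∈ coordSubgroup K (S : Set ι) i := ih hi.2 ▸ Subgroup.mem_top a
      have hb : b ∈ coordSubgroup K {j} i := hpair i j hi.1 ▸ Subgroup.mem_top b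
      obtain ⟨x, hxK, hxS, rfl⟩ := mem_coordSubgroup.1 ha
      obtain ⟨y, hyK, hyj, rfl⟩ := mem_coordSubgroup.1 hb
      have hmem : (x * y * x⁻¹ * y⁻¹) i ∈ coordSubgroup K (insert j S : Finset ι) i := by
        refine mem_coordSubgroup.2 ⟨x * y * x⁻¹ * y⁻¹, ?_, fun l hl => ?_, rfl⟩
        · exact K.mul_mem (K.mul_mem (K.mul_mem hxK hyK) (K.inv_mem hxK)) (K.inv_mem hyK)
        · rcases Finset.mem_insert.1 (Finset.mem_coe.1 hl) with rfl | hl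
          · simp [hyj l rfl]
          · simp [hxS l hl]
      rw [hbot, Subgroup.mem_bot] at hmem
      exact mul_inv_eq_iff_eq_mul.1 (mul_inv_eq_one.1 hmem)
  refine eq_top_iff.2 fun x _ => Subgroup.pi_mem_of_mulSingle_mem x fun i => ?_
  have hx : x i ∈ coordSubgroup K (Finset.univ.erase i : Finset ι) i :=
    hall i _ (Finset.notMem_erase i _) ▸ Subgroup.mem_top _
  obtain ⟨y, hyK, hyS, hyi⟩ := mem_coordSubgroup.1 hx
  convert hyK using 1
  ext j
  rcases eq_or_ne j i with rfl | hj
  · simp [hyi]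
  · rw [Pi.mulSingle_eq_of_ne hj, hyS j (by simp [hj])]

/-- The triple of elements of `Hᵏ` whose `j`-th coordinates are the entries of `C j`. -/
def tripleOfColumns (C : ι → H × H × H) : (ι → H) × (ι → H) × (ι → H) :=
  (fun j => (C j).1, fun j => (C j).2.1, fun j => (C j).2.2)

lemma isGenTriple_tripleOfColumns [Finite H] [IsSimpleGroup H] [Finite ι]
    (hna : ¬ ∀ x y : H, x * y = y * x) {C : ι → H × H × H} (hC : ∀ j, IsGenTriple (C j))
    (hne : ∀ i j, i ≠ j → ¬ TripleEquiv (C i) (C j)) : IsGenTriple (tripleOfColumns C) := by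
  refine ⟨funext fun j => (hC j).1, ?_⟩
  set K := Subgroup.closure {(tripleOfColumns C).1, (tripleOfColumns C).2.1,
    (tripleOfColumns C).2.2} with hKdef
  have h₁ : (tripleOfColumns C).1 ∈ K := Subgroup.subset_closure (by simp)
  have h₂ : (tripleOfColumns C).2.1 ∈ K := Subgroup.subset_closure (by simp)
  have h₃ : (tripleOfColumns C).2.2 ∈ K := Subgroup.subset_closure (by simp)
  let f : ∀ _ : ι, K →* H := fun j => (Pi.evalMonoidHom (fun _ => H) j).comp K.subtype
  have hf : ∀ j, Function.Surjective (f j) := fun j => by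
    rw [← MonoidHom.range_eq_top, eq_top_iff, ← (hC j).2, Subgroup.closure_le]
    rintro x (rfl | rfl | rfl)
    · exact ⟨⟨_, h₁⟩, rfl⟩
    · exact ⟨⟨_, h₂⟩, rfl⟩
    · exact ⟨⟨_, h₃⟩, rfl⟩
  refine subgroup_pi_eq_top hna (fun i h => ?_) fun i j hij => ?_
  · obtain ⟨x, hx⟩ := hf i h
    exact ⟨x, x.2, hx⟩
  · by_contra! hcon
    have hker : (f j).ker ≤ (f i).ker := fun x hx => hcon x x.2 hx
    let φ : H →* H := (f j).liftOfSurjective (hf j) ⟨f i, hker⟩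
    have hφ : ∀ x, φ (f j x) = f i x := fun x =>
      MonoidHom.liftOfRightInverse_comp_apply _ _ _ ⟨f i, hker⟩ x
    have hsurj : Function.Surjective φ := fun h => by
      obtain ⟨x, rfl⟩ := hf i h
      exact ⟨f j x, hφ x⟩
    exact hne j i hij.symm ⟨MulEquiv.ofBijective φ ⟨Finite.injective_iff_surjective.2 hsurj, hsurj⟩,
      hφ ⟨_, h₁⟩, hφ ⟨_, h₂⟩, hφ ⟨_, h₃⟩⟩

/-- A nontrivial power of prime order of `D` is supported on the `p`-full coordinates of `D`. -/
lemma apply_pow_ne_one_iff_pFull [Finite H] [Finite ι] {D : ι → H} {p n : ℕ} (hp : p.Prime)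
    (hn : orderOf (D ^ n) = p) (hfull : ∃ j, PFull H p (D j)) (j : ι) :
    (D ^ n) j ≠ 1 ↔ PFull H p (D j) := by
  have hexp : Monoid.exponent H ≠ 0 := Monoid.exponent_ne_zero_of_finite
  have hdvd : ∀ i, orderOf (D i) ∣ n * p := fun i => by
    refine orderOf_dvd_of_pow_eq_one ?_
    have := congrFun (pow_orderOf_eq_one (D ^ n)) i
    rwa [hn, ← pow_mul] at this
  have key : ∀ a, p ^ a ∣ n → ∀ i, (orderOf (D i)).factorization p ≤ a → (D ^ n) i = 1 := by
    intro a ha i hi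
    have hpos : orderOf (D i) ≠ 0 := (orderOf_pos _).ne'
    refine orderOf_dvd_iff_pow_eq_one.1 ?_
    rw [← Nat.ordProj_mul_ordCompl_eq_self (orderOf (D i)) p]
    have hcop := Nat.coprime_ordCompl hp hpos
    refine (hcop.pow_left _).mul_dvd_of_dvd_of_dvd ((pow_dvd_pow p hi).trans ha) ?_
    exact hcop.symm.dvd_of_dvd_mul_right ((Nat.ordCompl_dvd _ p).trans (hdvd i))
  have hle : ∀ i, (orderOf (D i)).factorization p ≤ (Monoid.exponent H).factorization p :=
    fun i => (Nat.factorization_le_iff_dvd (orderOf_pos _).ne' hexp).2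
      (Monoid.order_dvd_exponent _) p
  constructor
  · intro hj
    by_contra hnf
    obtain ⟨j₀, h₀⟩ := hfull
    rw [PFull, hp.pow_dvd_iff_le_factorization (orderOf_pos _).ne', not_le] at hnf
    refine hj (key ((Monoid.exponent H).factorization p - 1) ?_ j (by omega))
    refine Nat.dvd_of_mul_dvd_mul_right hp.pos ?_
    rw [← pow_succ, Nat.sub_add_cancel (by omega)]
    exact h₀.trans (hdvd j₀)
  · intro hj h1
    refine hp.one_lt.ne' (hn.symm.trans (orderOf_eq_one_iff.2 (funext fun i => ?_)))
    exact key _ (hj.trans (orderOf_dvd_iff_pow_eq_one.2 h1)) i (hle i)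

end DirectPower

section Entries

variable {H : Type*} [Group H]

/-- The `r`-th entry of a triple. -/
def tripleEntry (r : Fin 3) (T : H × H × H) : H := (cycShift^[(r : ℕ)] T).1

lemma sum_tripleEntry {α M : Type*} [AddCommMonoid M] (f : α → M) (r : Fin 3) (T : α × α × α) :
    ∑ m : Fin 3, f (tripleEntry r (cycShift^[(m : ℕ)] T)) = f T.1 + f T.2.1 + f T.2.2 := by
  rw [Fin.sum_univ_three]
  fin_cases r <;> dsimp [tripleEntry, cycShift] <;> abel

open scoped Classical in
lemma sum_pFull_tripleEntry (p : ℕ) (r : Fin 3) (T : H × H × H) :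
    ∑ m : Fin 3, (if PFull H p (tripleEntry r (cycShift^[(m : ℕ)] T)) then 1 else 0) = nuP p T :=
  sum_tripleEntry (fun x => if PFull H p x then 1 else 0) r T

lemma mem_sigmaSet_tripleOfColumns [Finite H] {ι : Type*} [Finite ι] {C : ι → H × H × H}
    {x : ι → H} (hx : x ∈ SigmaSet (tripleOfColumns C)) :
    ∃ (g : ι → H) (r : Fin 3) (n : ℕ), g * x * g⁻¹ = (fun j => tripleEntry r (C j)) ^ n := by
  obtain ⟨g, (h | h) | h⟩ := hx <;>
    obtain ⟨n, hn⟩ := mem_powers_iff_mem_zpowers.2 h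
  · exact ⟨g, 0, n, hn.symm⟩
  · exact ⟨g, 1, n, hn.symm⟩
  · exact ⟨g, 2, n, hn.symm⟩

lemma one_mem_sigmaSet (T : H × H × H) : 1 ∈ SigmaSet T :=
  ⟨1, Or.inl (Or.inl (by simp))⟩

lemma isGenTriple_cycShift {T : H × H × H} (hT : IsGenTriple T) : IsGenTriple (cycShift T) := by
  refine ⟨?_, ?_⟩
  · have h := eq_inv_of_mul_eq_one_left (mul_assoc T.1 _ _ ▸ hT.1)
    simp [cycShift, h]
  · rw [← hT.2]
    congr 1
    ext x
    simp only [cycShift, Set.mem_insert_iff, Set.mem_singleton_iff]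
    tauto

lemma isGenTriple_iterate_cycShift {T : H × H × H} (hT : IsGenTriple T) (m : ℕ) :
    IsGenTriple (cycShift^[m] T) := by
  induction m with
  | zero => exact hT
  | succ m ih => rw [Function.iterate_succ_apply']; exact isGenTriple_cycShift ih

variable (H) in
/-- Equivalence of generating triples under automorphisms. -/
def genTripleSetoid : Setoid {T : H × H × H // IsGenTriple T} where
  r T T' := TripleEquiv T.1 T'.1
  iseqv :=
    { refl := fun _ => ⟨1, rfl, rfl, rfl⟩
      symm := fun ⟨α, h₁, h₂, h₃⟩ =>
        ⟨α⁻¹, by simp [← h₁], by simp [← h₂], by simp [← h₃]⟩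
      trans := fun ⟨α, h₁, h₂, h₃⟩ ⟨β, g₁, g₂, g₃⟩ =>
        ⟨β * α, by simp [*], by simp [*], by simp [*]⟩ }

lemma phi2_le_card_quotient_mul [Finite H] :
    phi2 H ≤ Nat.card (Quotient (genTripleSetoid H)) * Nat.card (MulAut H) := by
  have hgen : ∀ p : {p : H × H // Subgroup.closure {p.1, p.2} = ⊤},
      IsGenTriple (p.1.1, p.1.2, (p.1.1 * p.1.2)⁻¹) := fun p => by
    refine ⟨mul_inv_cancel _, top_le_iff.1 (p.2.symm.le.trans (Subgroup.closure_mono ?_))⟩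
    grind
  have hfin : Finite (MulAut H) := Finite.of_injective _ MulEquiv.toEquiv_injective
  rw [phi2, ← Nat.card_prod]
  have hex : ∀ T : {T : H × H × H // IsGenTriple T},
      TripleEquiv (Quotient.out (s := genTripleSetoid H) ⟦T⟧).1 T.1 := fun T =>
    Quotient.mk_out (s := genTripleSetoid H) T
  choose α hα using hex
  refine Nat.card_le_card_of_injective
    (fun p => (⟦⟨_, hgen p⟩⟧, α ⟨_, hgen p⟩)) fun p q hpq => ?_
  obtain ⟨hq, hα'⟩ := Prod.ext_iff.1 hpq
  dsimp only at hq hα'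
  have hP := hα ⟨_, hgen p⟩
  have hQ := hα ⟨_, hgen q⟩
  rw [hq, hα'] at hP
  exact Subtype.ext (Prod.ext (hP.1.symm.trans hQ.1) (hP.2.1.symm.trans hQ.2.1))

/-- A family of pairwise inequivalent generating triples extends to one of any size `k` not
exceeding the number of classes. -/
lemma exists_columns [Finite H] {κ : Type*} [Finite κ] {U : κ → H × H × H}
    (hU : ∀ x, IsGenTriple (U x)) (hne : ∀ x y, x ≠ y → ¬ TripleEquiv (U x) (U y)) {k : ℕ}
    (hk : Nat.card κ ≤ k) (hk' : k * Nat.card (MulAut H) ≤ phi2 H) :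
    ∃ (e : κ ↪ Fin k) (C : Fin k → H × H × H), (∀ x, C (e x) = U x) ∧
      (∀ j, IsGenTriple (C j)) ∧ ∀ i j, i ≠ j → ¬ TripleEquiv (C i) (C j) := by
  classical
  have hfin : Finite (MulAut H) := Finite.of_injective _ MulEquiv.toEquiv_injective
  have := Fintype.ofFinite κ
  have := Fintype.ofFinite (Quotient (genTripleSetoid H))
  have hcard : k ≤ Nat.card (Quotient (genTripleSetoid H)) :=
    Nat.le_of_mul_le_mul_right (hk'.trans phi2_le_card_quotient_mul) Nat.card_pos
  let U' : κ → {T : H × H × H // IsGenTriple T} := fun x => ⟨U x, hU x⟩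
  let g : κ → Quotient (genTripleSetoid H) := fun x => ⟦U' x⟧
  have hg : Function.Injective g := fun x y hxy => by
    by_contra hne'
    exact hne x y hne' (Quotient.exact hxy)
  obtain ⟨S, hgS, -, hS⟩ := Finset.exists_subsuperset_card_eq (n := k)
    (Finset.subset_univ (Finset.univ.image g))
    (by rwa [Finset.card_image_of_injective _ hg, Finset.card_univ, ← Nat.card_eq_fintype_card])
    (by rwa [Finset.card_univ, ← Nat.card_eq_fintype_card])
  let σ : S ≃ Fin k := S.equivFinOfCardEq hS
  have hmem : ∀ x, g x ∈ S := fun x => hgS (Finset.mem_image_of_mem g (Finset.mem_univ x))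
  let rep : Quotient (genTripleSetoid H) → {T : H × H × H // IsGenTriple T} :=
    Function.extend g U' Quotient.out
  have hrep : ∀ q, ⟦rep q⟧ = q := fun q => by
    by_cases hq : ∃ x, g x = q
    · obtain ⟨x, rfl⟩ := hq
      simp only [rep, hg.extend_apply, g]
    · simp only [rep, Function.extend_apply' _ _ _ hq, Quotient.out_eq]
  refine ⟨⟨fun x => σ ⟨g x, hmem x⟩, fun x y hxy => hg (Subtype.ext_iff.1 (σ.injective hxy))⟩,
    fun j => (rep (σ.symm j)).1, fun x => ?_, fun j => (rep _).2, fun i j hij h => hij ?_⟩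
  · change (rep (σ.symm (σ ⟨g x, hmem x⟩))).1 = U x
    rw [σ.symm_apply_apply]
    simp only [rep, hg.extend_apply, U']
  · have : (⟦rep (σ.symm i)⟧ : Quotient (genTripleSetoid H)) = ⟦rep (σ.symm j)⟧ := Quotient.sound h
    rw [hrep, hrep] at this
    exact σ.symm.injective (Subtype.ext this)

lemma four_le_of_forall_prime_dvd [Finite H] [IsSimpleGroup H]
    (hna : ¬ ∀ x y : H, x * y = y * x) {n : ℕ} (hn : 0 < n)
    (h : ∀ p : ℕ, p.Prime → p ∣ Nat.card H → p ∣ n) : 4 ≤ n := by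
  have key : ∀ p : ℕ, p.Prime → ∃ q : ℕ, q.Prime ∧ q ∣ Nat.card H ∧ q ≠ p := by
    intro p hp
    by_contra! hcon
    have : Fact p.Prime := ⟨hp⟩
    have hpow := Nat.eq_prime_pow_of_unique_prime_dvd (p := p) (Nat.card_pos (α := H)).ne'
      fun {d} hd hdvd => hcon d hd hdvd
    have := (IsPGroup.of_card hpow).isNilpotent
    exact hna (IsSimpleGroup.comm_iff_isSolvable.2 inferInstance)
  by_contra! hlt
  obtain ⟨q, hq, hqH, hq2⟩ := key 2 Nat.prime_two
  obtain ⟨q', hq', hqH', hq3⟩ := key 3 Nat.prime_three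
  have h₁ := Nat.le_of_dvd hn (h q hq hqH)
  have h₂ := Nat.le_of_dvd hn (h q' hq' hqH')
  have := hq.two_le
  have := hq'.two_le
  obtain rfl : q = 3 := by omega
  obtain rfl : q' = 2 := by omega
  have := h 2 hq' hqH'
  have := h 3 hq hqH
  omega

lemma isHyperbolic_of_four_le {G : Type*} [Group G] {T : G × G × G} (h₁ : 4 ≤ orderOf T.1)
    (h₂ : 4 ≤ orderOf T.2.1) (h₃ : 4 ≤ orderOf T.2.2) : IsHyperbolic T := by
  have key : ∀ n : ℕ, 4 ≤ n → (n : ℚ)⁻¹ ≤ 4⁻¹ := fun n hn =>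
    inv_anti₀ (by norm_num) (by exact_mod_cast hn)
  have := key _ h₁
  have := key _ h₂
  have := key _ h₃
  unfold IsHyperbolic
  linarith

lemma isHyperbolic_tripleOfColumns [Finite H] [IsSimpleGroup H] {ι : Type*} [Finite ι]
    (hna : ¬ ∀ x y : H, x * y = y * x) {C : ι → H × H × H}
    (hfull : ∀ p : ℕ, p.Prime → p ∣ Nat.card H → ∀ r, ∃ j, PFull H p (tripleEntry r (C j))) :
    IsHyperbolic (tripleOfColumns C) := by
  have key : ∀ r, 4 ≤ orderOf fun j => tripleEntry r (C j) := fun r => by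
    refine four_le_of_forall_prime_dvd hna (orderOf_pos _) fun p hp hdvd => ?_
    obtain ⟨j, hj⟩ := hfull p hp hdvd r
    have : Fact p.Prime := ⟨hp⟩
    obtain ⟨x, hx⟩ := exists_prime_orderOf_dvd_card' (G := H) p hdvd
    have hpe : p ∣ Monoid.exponent H := hx ▸ Monoid.order_dvd_exponent x
    have hpos := hp.factorization_pos_of_dvd Monoid.exponent_ne_zero_of_finite hpe
    exact ((dvd_pow_self p hpos.ne').trans hj).trans
      (orderOf_map_dvd (Pi.evalMonoidHom (fun _ => H) j) _)
  exact isHyperbolic_of_four_le (key 0) (key 1) (key 2)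

/-- If nontrivial elements of prime order of `Σ(T₁)` and `Σ(T₂)` always have different supports,
then `Σ(T₁) ∩ Σ(T₂)` is trivial. -/
lemma sigmaSet_inter_eq_one [Finite H] {ι : Type*} [Finite ι] {C C' : ι → H × H × H}
    (hfull : ∀ p : ℕ, p.Prime → p ∣ Nat.card H → ∀ r, ∃ j, PFull H p (tripleEntry r (C j)))
    (hfull' : ∀ p : ℕ, p.Prime → p ∣ Nat.card H → ∀ r, ∃ j, PFull H p (tripleEntry r (C' j)))
    (hdiff : ∀ p : ℕ, p.Prime → p ∣ Nat.card H → ∀ r r',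
      ∃ j, ¬ (PFull H p (tripleEntry r (C j)) ↔ PFull H p (tripleEntry r' (C' j)))) :
    SigmaSet (tripleOfColumns C) ∩ SigmaSet (tripleOfColumns C') = {1} := by
  refine Set.eq_singleton_iff_unique_mem.2
    ⟨⟨one_mem_sigmaSet _, one_mem_sigmaSet _⟩, fun x ⟨hx, hx'⟩ => ?_⟩
  by_contra hx1
  obtain ⟨p, hp, hpx⟩ := Nat.exists_prime_and_dvd (mt orderOf_eq_one_iff.1 hx1)
  have hpH : p ∣ Nat.card H := by
    have h : p ∣ Nat.card (ι → H) := hpx.trans (orderOf_dvd_natCard x)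
    rw [Nat.card_fun] at h
    exact hp.dvd_of_dvd_pow h
  have supp : ∀ {D : ι → H} {g : ι → H} {n : ℕ}, g * x * g⁻¹ = D ^ n →
      (∃ j, PFull H p (D j)) → ∀ j, (x ^ (orderOf x / p)) j ≠ 1 ↔ PFull H p (D j) := by
    intro D g n hg hD j
    have hconj : g * x ^ (orderOf x / p) * g⁻¹ = D ^ (n * (orderOf x / p)) := by
      rw [pow_mul, ← hg, conj_pow]
    rw [← apply_pow_ne_one_iff_pFull (n := n * (orderOf x / p)) hp ?_ hD j, ← hconj]
    · simp
    · rw [← hconj, ← MulAut.conj_apply, MulEquiv.orderOf_eq,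
        orderOf_pow_orderOf_div (orderOf_pos x).ne' hpx]
  obtain ⟨g, r, n, hg⟩ := mem_sigmaSet_tripleOfColumns hx
  obtain ⟨g', r', n', hg'⟩ := mem_sigmaSet_tripleOfColumns hx'
  obtain ⟨j, hj⟩ := hdiff p hp hpH r r'
  exact hj ((supp hg (hfull p hp hpH r) j).symm.trans (supp hg' (hfull' p hp hpH r') j))

end Entries

/-- Lemma 4.3: if `H` has `t` ordered pairs of generating triples such that every prime
dividing `|H|` admits a `p`-distinguishing pair among them, and the `6t` triples `T_{i,s}`
together with their cyclic permutations are pairwise inequivalent, then `Hᵏ` is a Beauville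
group for every `k` with `6t ≤ k` and `k·|Aut H| ≤ φ₂(H)`. -/
theorem beauville_of_distinguishing (H : Type*) [Group H] [Finite H]
    [IsSimpleGroup H] (hna : ¬ ∀ x y : H, x * y = y * x)
    (t : ℕ) (T : Fin 2 → Fin t → H × H × H)
    (hgen : ∀ i s, IsGenTriple (T i s))
    (h1 : ∀ p : ℕ, p.Prime → p ∣ Nat.card H →
      ∃ s, PDistinguishing p (T 0 s) (T 1 s))
    (h2 : ∀ i i' : Fin 2, ∀ s s' : Fin t, ∀ m m' : Fin 3, (i, s, m) ≠ (i', s', m') →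
      ¬ TripleEquiv (cycShift^[(m : ℕ)] (T i s)) (cycShift^[(m' : ℕ)] (T i' s')))
    (k : ℕ) (hk : 6 * t ≤ k) (hk' : k * Nat.card (MulAut H) ≤ phi2 H) :
    HasBeauvilleStructure (Fin k → H) := by
  classical
  obtain ⟨e, C, hCe, hC, hne⟩ := exists_columns
    (U := fun x : Fin 2 × Fin t × Fin 3 => cycShift^[(x.2.2 : ℕ)] (T x.1 x.2.1))
    (fun x => isGenTriple_iterate_cycShift (hgen _ _) _)
    (fun x y hxy => h2 _ _ _ _ _ _ hxy) (k := k) (by simp; omega) hk'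
  let swap : Equiv.Perm (Fin 2 × Fin t × Fin 3) := (Equiv.swap 0 1).prodCongr (Equiv.refl _)
  let π : Equiv.Perm (Fin k) := swap.viaEmbedding e
  have hπ : ∀ i s m, C (π (e (i, s, m))) = cycShift^[(m : ℕ)] (T (Equiv.swap 0 1 i) s) := by
    intro i s m
    rw [Equiv.Perm.viaEmbedding_apply, hCe]
    rfl
  have hfull : ∀ p : ℕ, p.Prime → p ∣ Nat.card H → ∀ r, ∃ j, PFull H p (tripleEntry r (C j)) := by
    intro p hp hpH r
    by_contra! hcon
    obtain ⟨s, hs⟩ := h1 p hp hpH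
    have hz : ∀ i, nuP p (T i s) = 0 := fun i => by
      rw [← sum_pFull_tripleEntry p r]
      refine Finset.sum_eq_zero fun m _ => if_neg ?_
      simpa only [hCe] using hcon (e (i, s, m))
    exact hs ((hz 0).trans (hz 1).symm)
  have hfull' : ∀ p : ℕ, p.Prime → p ∣ Nat.card H → ∀ r,
      ∃ j, PFull H p (tripleEntry r (C (π j))) := fun p hp hpH r => by
    obtain ⟨j, hj⟩ := hfull p hp hpH r
    exact ⟨π.symm j, by rwa [π.apply_symm_apply]⟩
  refine ⟨tripleOfColumns C, tripleOfColumns fun j => C (π j),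
    isGenTriple_tripleOfColumns hna hC hne, isHyperbolic_tripleOfColumns hna hfull,
    isGenTriple_tripleOfColumns hna (fun j => hC _) fun i j hij => hne _ _ (π.injective.ne hij),
    isHyperbolic_tripleOfColumns hna hfull', sigmaSet_inter_eq_one hfull hfull' ?_⟩
  intro p hp hpH r r'
  by_contra! hcon
  obtain ⟨s, hs⟩ := h1 p hp hpH
  refine hs ?_
  rw [← sum_pFull_tripleEntry p r, ← sum_pFull_tripleEntry p r']
  refine Finset.sum_congr rfl fun m _ => if_congr ?_ rfl rfl
  simpa only [hCe, hπ, Equiv.swap_apply_left] using hcon (e (0, s, m))
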